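/- arXiv:1710.11457 — 2 statements merged into one kernel-verified Lean document; each statement's English description precedes it below -/
import Mathlib

section
/- Let J, E be twice continuously differentiable ℝ³-valued fields and N_e a continuously differentiable real-valued field on ℝ³×[0,T] satisfying the Drude equation ∂ₜJ = −ν_e J + N_e E, with J and E satisfying the Dirichlet support condition. Then ‖∇·J(·,T)‖²_{L²(Ω)} = ‖∇·J(·,0)‖²_{L²(Ω)} − 2ν_e ∫₀ᵀ ‖∇·J(·,t)‖²_{L²(Ω)} dt + 2∫₀ᵀ∫_Ω (∇N_e(x,t)·E(x,t)) (∇·J)(x,t) dx dt + 2∫₀ᵀ∫_Ω N_e(x,t) (∇·E)(x,t) (∇·J)(x,t) dx dt. -/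
open MeasureTheory
open scoped RealInnerProductSpace

noncomputable section

/-- `V3` is Euclidean three-dimensional space. -/
abbrev V3 : Type := EuclideanSpace ℝ (Fin 3)

/-- spatial partial derivative in direction `i` of a scalar field -/
def pd (i : Fin 3) (g : V3 → ℝ) (x : V3) : ℝ :=
  fderiv ℝ g x (EuclideanSpace.single i 1)

/-- spatial divergence of a vector field -/
def sdiv (F : V3 → V3) (x : V3) : ℝ := ∑ i, pd i (fun y => F y i) x

/-- build a vector in `V3` from three coordinates -/
def vec3 (a b c : ℝ) : V3 := (WithLp.equiv 2 (Fin 3 → ℝ)).symm ![a, b, c]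

/-- spatial curl of a vector field -/
def scurl (F : V3 → V3) (x : V3) : V3 :=
  vec3 (pd 1 (fun y => F y 2) x - pd 2 (fun y => F y 1) x)
       (pd 2 (fun y => F y 0) x - pd 0 (fun y => F y 2) x)
       (pd 0 (fun y => F y 1) x - pd 1 (fun y => F y 0) x)

/-- spatial gradient of a scalar field -/
def sgrad (g : V3 → ℝ) (x : V3) : V3 :=
  (WithLp.equiv 2 (Fin 3 → ℝ)).symm (fun i => pd i g x)

/-- spatial Laplacian of a scalar field -/
def slap (g : V3 → ℝ) (x : V3) : ℝ := ∑ i, pd i (fun y => pd i g y) x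

/-- componentwise spatial Laplacian of a vector field -/
def veclap (F : V3 → V3) (x : V3) : V3 :=
  (WithLp.equiv 2 (Fin 3 → ℝ)).symm (fun i => slap (fun y => F y i) x)

/-- cross product on `V3` -/
def cross3 (a b : V3) : V3 :=
  vec3 (a 1 * b 2 - a 2 * b 1) (a 2 * b 0 - a 0 * b 2) (a 0 * b 1 - a 1 * b 0)

/-- The Dirichlet support condition: for every `t ∈ [0,T]` the spatial support of the
field is contained in a fixed compact subset of `Ω` (encoding zero Dirichlet BCs). -/
def DirichletBC {α : Type} [Zero α] (Ω : Set V3) (T : ℝ) (F : V3 → ℝ → α) : Prop :=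
  ∃ K : Set V3, IsCompact K ∧ K ⊆ Ω ∧
    ∀ t ∈ Set.Icc (0:ℝ) T, (Function.support fun x => F x t) ⊆ K

theorem hasFDerivAt_slice {g : V3 × ℝ → ℝ} {x : V3} {t : ℝ} (hg : DifferentiableAt ℝ g (x, t)) :
    HasFDerivAt (fun y => g (y, t))
      ((fderiv ℝ g (x, t)).comp (ContinuousLinearMap.inl ℝ V3 ℝ)) x :=
  hg.hasFDerivAt.comp x (hasFDerivAt_prodMk_left x t)

theorem pd_slice {g : V3 × ℝ → ℝ} {x : V3} {t : ℝ} (hg : DifferentiableAt ℝ g (x, t))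
    (i : Fin 3) :
    pd i (fun y => g (y, t)) x = fderiv ℝ g (x, t) (EuclideanSpace.single i 1, 0) := by
  simp [pd, (hasFDerivAt_slice hg).fderiv]

theorem hasDerivAt_slice {g : V3 × ℝ → ℝ} {x : V3} {t : ℝ} (hg : DifferentiableAt ℝ g (x, t)) :
    HasDerivAt (fun s => g (x, s)) (fderiv ℝ g (x, t) (0, 1)) t := by
  have h := (hg.hasFDerivAt.comp t (hasFDerivAt_prodMk_right x t)).hasDerivAt
  simpa [Function.comp_def] using h

theorem continuous_pd_slice {g : V3 × ℝ → ℝ} (hg : ContDiff ℝ 1 g) (i : Fin 3) :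
    Continuous (fun p : V3 × ℝ => pd i (fun y => g (y, p.2)) p.1) := by
  have h : (fun p : V3 × ℝ => pd i (fun y => g (y, p.2)) p.1)
      = fun p => fderiv ℝ g p (EuclideanSpace.single i 1, 0) :=
    funext fun p => pd_slice (hg.differentiable one_ne_zero (p.1, p.2)) i
  rw [h]
  exact (hg.continuous_fderiv one_ne_zero).clm_apply continuous_const

/-- Time and space derivatives of a twice continuously differentiable field commute. -/
theorem hasDerivAt_pd_slice {g : V3 × ℝ → ℝ} (hg : ContDiff ℝ 2 g) (i : Fin 3) (x : V3) (t : ℝ) :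
    HasDerivAt (fun s => pd i (fun y => g (y, s)) x)
      (pd i (fun y => deriv (fun s => g (y, s)) t) x) t := by
  have hd : Differentiable ℝ g := hg.differentiable two_ne_zero
  have hd2 : Differentiable ℝ (fderiv ℝ g) :=
    (hg.fderiv_right (m := 1) (by norm_num)).differentiable one_ne_zero
  have hsymm : IsSymmSndFDerivAt ℝ g (x, t) :=
    hg.contDiffAt.isSymmSndFDerivAt (by simp)
  have key (v : V3 × ℝ) : HasFDerivAt (fun p => fderiv ℝ g p v)
      ((fderiv ℝ (fderiv ℝ g) (x, t)).flip v) (x, t) := by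
    simpa using (hd2 (x, t)).hasFDerivAt.clm_apply (hasFDerivAt_const v (x, t))
  have h1 : (fun s => pd i (fun y => g (y, s)) x)
      = fun s => fderiv ℝ g (x, s) (EuclideanSpace.single i 1, 0) :=
    funext fun s => pd_slice (hd (x, s)) i
  have h2 : (fun y => deriv (fun s => g (y, s)) t) = fun y => fderiv ℝ g (y, t) (0, 1) :=
    funext fun y => (hasDerivAt_slice (hd (y, t))).deriv
  rw [h1, h2, pd_slice (g := fun p => fderiv ℝ g p (0, 1)) (key _).differentiableAt,
    (key _).fderiv, ContinuousLinearMap.flip_apply, hsymm.eq]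
  have h := hasDerivAt_slice (key (EuclideanSpace.single i 1, 0)).differentiableAt
  rwa [(key _).fderiv, ContinuousLinearMap.flip_apply] at h

theorem contDiff_coord {F : V3 → ℝ → V3} {n : WithTop ℕ∞}
    (hF : ContDiff ℝ n (fun p : V3 × ℝ => F p.1 p.2)) (i : Fin 3) :
    ContDiff ℝ n (fun p : V3 × ℝ => F p.1 p.2 i) :=
  (contDiff_euclidean.1 hF) i

theorem continuous_sdiv_slice {F : V3 → ℝ → V3}
    (hF : ContDiff ℝ 1 (fun p : V3 × ℝ => F p.1 p.2)) :
    Continuous (fun p : V3 × ℝ => sdiv (fun y => F y p.2) p.1) :=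
  continuous_finsetSum _ fun i _ => continuous_pd_slice (contDiff_coord hF i) i

theorem inner_sgrad (g : V3 → ℝ) (x v : V3) : ⟪sgrad g x, v⟫ = ∑ i, pd i g x * v i := by
  simp [sgrad, PiLp.inner_apply, mul_comm]

theorem continuous_inner_sgrad_slice {N : V3 → ℝ → ℝ} {F : V3 → ℝ → V3}
    (hN : ContDiff ℝ 1 (fun p : V3 × ℝ => N p.1 p.2))
    (hF : ContDiff ℝ 1 (fun p : V3 × ℝ => F p.1 p.2)) :
    Continuous (fun p : V3 × ℝ => ⟪sgrad (fun y => N y p.2) p.1, F p.1 p.2⟫) := by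
  simp only [inner_sgrad]
  exact continuous_finsetSum _ fun i _ =>
    (continuous_pd_slice hN i).mul (contDiff_coord hF i).continuous

/-- The divergence of the Drude equation. -/
theorem hasDerivAt_sdiv_of_drude {J E : V3 → ℝ → V3} {Ne : V3 → ℝ → ℝ} {νe t : ℝ}
    (hJ : ContDiff ℝ 2 (fun p : V3 × ℝ => J p.1 p.2))
    (hE : ContDiff ℝ 1 (fun p : V3 × ℝ => E p.1 p.2))
    (hNe : ContDiff ℝ 1 (fun p : V3 × ℝ => Ne p.1 p.2))
    (hDrude : ∀ x, deriv (J x) t = -(νe • J x t) + Ne x t • E x t) (x : V3) :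
    HasDerivAt (fun s => sdiv (fun y => J y s) x)
      (-νe * sdiv (fun y => J y t) x + ⟪sgrad (fun y => Ne y t) x, E x t⟫
        + Ne x t * sdiv (fun y => E y t) x) t := by
  have h := HasDerivAt.fun_sum (u := Finset.univ)
    fun i (_ : i ∈ Finset.univ) => hasDerivAt_pd_slice (contDiff_coord hJ i) i x t
  refine h.congr_deriv ?_
  have hc (i : Fin 3) (y : V3) :
      deriv (fun s => J y s i) t = -(νe * J y t i) + Ne y t * E y t i := by
    have hJy : DifferentiableAt ℝ (J y) t :=
      ((hJ.differentiable two_ne_zero).comp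
        ((differentiable_const y).prodMk differentiable_id)) t
    have := ((EuclideanSpace.proj (𝕜 := ℝ) i).hasFDerivAt.comp_hasDerivAt t hJy.hasDerivAt).deriv
    simp only [Function.comp_def, PiLp.proj_apply] at this
    rw [this, hDrude]
    simp
  simp only [hc, inner_sgrad, sdiv, Finset.mul_sum, ← Finset.sum_add_distrib]
  refine Finset.sum_congr rfl fun i _ => ?_
  have dJ := hasFDerivAt_slice ((contDiff_coord hJ i).differentiable two_ne_zero (x, t))
  have dE := hasFDerivAt_slice ((contDiff_coord hE i).differentiable one_ne_zero (x, t))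
  have dN := hasFDerivAt_slice (hNe.differentiable one_ne_zero (x, t))
  have hs := ((dJ.const_mul νe).fun_neg).fun_add (dN.fun_mul dE)
  simp only [pd]
  rw [hs.fderiv, dJ.fderiv, dE.fderiv, dN.fderiv]
  simp
  ring

theorem integrable_prod_of_isBounded {Ω : Set V3} (hΩ : Bornology.IsBounded Ω) (T : ℝ)
    {f : V3 × ℝ → ℝ} (hf : Continuous f) :
    Integrable f ((volume.restrict Ω).prod (volume.restrict (Set.Ioc 0 T))) := by
  rw [Measure.prod_restrict]
  have hK : IsCompact (closure Ω ×ˢ Set.Icc 0 T) := hΩ.isCompact_closure.prod isCompact_Icc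
  exact (hf.continuousOn.integrableOn_compact hK).mono_set
    (Set.prod_mono subset_closure Set.Ioc_subset_Icc_self)

theorem drude_divJ_L2_identity (Ω : Set V3) (hΩo : IsOpen Ω) (hΩb : Bornology.IsBounded Ω)
    (T : ℝ) (hT : 0 < T)
    (νe : ℝ) (hνe : 0 ≤ νe) (J E : V3 → ℝ → V3) (Ne : V3 → ℝ → ℝ)
    (hJ : ContDiff ℝ 2 (fun p : V3 × ℝ => J p.1 p.2)) (hE : ContDiff ℝ 2 (fun p : V3 × ℝ => E p.1 p.2))
    (hNe : ContDiff ℝ 1 (fun p : V3 × ℝ => Ne p.1 p.2))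
    (hDrude : ∀ x : V3, ∀ t ∈ Set.Icc (0:ℝ) T,
      deriv (J x) t = -(νe • J x t) + Ne x t • E x t)
    (hJbc : DirichletBC Ω T J) (hEbc : DirichletBC Ω T E) :
    (∫ x in Ω, (sdiv (fun y => J y T) x)^2)
      = (∫ x in Ω, (sdiv (fun y => J y 0) x)^2)
        - 2*νe * (∫ t in (0:ℝ)..T, ∫ x in Ω, (sdiv (fun y => J y t) x)^2)
        + 2 * (∫ t in (0:ℝ)..T, ∫ x in Ω,
            ⟪sgrad (fun y => Ne y t) x, E x t⟫ * sdiv (fun y => J y t) x)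
        + 2 * (∫ t in (0:ℝ)..T, ∫ x in Ω,
            Ne x t * sdiv (fun y => E y t) x * sdiv (fun y => J y t) x) := by
  have hJ1 := hJ.of_le (m := 1) (by norm_num)
  have hE1 := hE.of_le (m := 1) (by norm_num)
  have cJ := continuous_sdiv_slice hJ1
  have cE := continuous_sdiv_slice hE1
  have cG := continuous_inner_sgrad_slice hNe hE1
  set d : V3 → ℝ → ℝ := fun x t => sdiv (fun y => J y t) x
  set e : V3 → ℝ → ℝ := fun x t => sdiv (fun y => E y t) x
  set g : V3 → ℝ → ℝ := fun x t => ⟪sgrad (fun y => Ne y t) x, E x t⟫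
  change Continuous (fun p : V3 × ℝ => d p.1 p.2) at cJ
  change Continuous (fun p : V3 × ℝ => e p.1 p.2) at cE
  change Continuous (fun p : V3 × ℝ => g p.1 p.2) at cG
  change (∫ x in Ω, (d x T)^2) = (∫ x in Ω, (d x 0)^2)
    - 2*νe * (∫ t in (0:ℝ)..T, ∫ x in Ω, (d x t)^2)
    + 2 * (∫ t in (0:ℝ)..T, ∫ x in Ω, g x t * d x t)
    + 2 * (∫ t in (0:ℝ)..T, ∫ x in Ω, Ne x t * e x t * d x t)
  have i1 : Integrable (Function.uncurry fun x t => d x t ^ 2)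
      ((volume.restrict Ω).prod (volume.restrict (Set.Ioc 0 T))) :=
    integrable_prod_of_isBounded hΩb T (cJ.pow 2)
  have i2 : Integrable (Function.uncurry fun x t => g x t * d x t)
      ((volume.restrict Ω).prod (volume.restrict (Set.Ioc 0 T))) :=
    integrable_prod_of_isBounded hΩb T (cG.mul cJ)
  have i3 : Integrable (Function.uncurry fun x t => Ne x t * e x t * d x t)
      ((volume.restrict Ω).prod (volume.restrict (Set.Ioc 0 T))) :=
    integrable_prod_of_isBounded hΩb T ((hNe.continuous.mul cE).mul cJ)
  have ftc (x : V3) : d x T ^ 2 - d x 0 ^ 2 = -2 * νe * (∫ t in Set.Ioc 0 T, d x t ^ 2)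
      + 2 * (∫ t in Set.Ioc 0 T, g x t * d x t)
      + 2 * (∫ t in Set.Ioc 0 T, Ne x t * e x t * d x t) := by
    have cx : Continuous (fun t : ℝ => (x, t)) := by fun_prop
    have c1 : Continuous (fun t => d x t ^ 2) := (cJ.pow 2).comp cx
    have c2 : Continuous (fun t => g x t * d x t) := (cG.mul cJ).comp cx
    have c3 : Continuous (fun t => Ne x t * e x t * d x t) :=
      ((hNe.continuous.mul cE).mul cJ).comp cx
    have hder : ∀ t ∈ Set.uIcc 0 T, HasDerivAt (fun t => d x t ^ 2)
        (-2 * νe * d x t ^ 2 + 2 * (g x t * d x t) + 2 * (Ne x t * e x t * d x t)) t := by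
      intro t ht
      rw [Set.uIcc_of_le hT.le] at ht
      refine ((hasDerivAt_sdiv_of_drude hJ hE1 hNe (fun y => hDrude y t ht) x).fun_pow 2).congr_deriv ?_
      simp only [d, e, g]
      ring
    have h := intervalIntegral.integral_eq_sub_of_hasDerivAt hder
      (Continuous.intervalIntegrable (by fun_prop) 0 T)
    rw [← h, intervalIntegral.integral_add, intervalIntegral.integral_add]
    · simp only [integral_const_mul, intervalIntegral.integral_of_le hT.le]
    all_goals exact Continuous.intervalIntegrable (by fun_prop) 0 T
  have slice (s : ℝ) : Integrable (fun x => d x s ^ 2) (volume.restrict Ω) :=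
    ((((cJ.pow 2).comp (continuous_id.prodMk continuous_const)).continuousOn.integrableOn_compact
      hΩb.isCompact_closure).mono_set subset_closure :
      IntegrableOn (fun x => d x s ^ 2) Ω volume)
  have hint := integral_congr_ae (μ := volume.restrict Ω) (Filter.Eventually.of_forall ftc)
  rw [integral_sub (slice T) (slice 0), integral_add, integral_add, integral_const_mul,
    integral_const_mul, integral_const_mul, integral_integral_swap i1,
    integral_integral_swap i2, integral_integral_swap i3] at hint
  · simp only [intervalIntegral.integral_of_le hT.le]
    linarith
  · exact i1.integral_prod_left.const_mul _
  · exact i2.integral_prod_left.const_mul _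
  · exact (i1.integral_prod_left.const_mul _).add (i2.integral_prod_left.const_mul _)
  · exact i3.integral_prod_left.const_mul _
end
end

section
/- Let E, B, P, J be continuously differentiable ℝ³-valued fields and N_e a continuous real-valued field on ℝ³×[0,T] satisfying the Ampère–Maxwell law ∂ₜE = c∇×B − 4π∂ₜP − 4πJ, the Faraday law ∂ₜB = −c∇×E and the Drude equation ∂ₜJ = −ν_e J + N_e E, with E, B, J satisfying the Dirichlet support condition, and let η > 0. Set M := sup_{Ω×[0,T]} N_e². Then ‖E(·,T)‖²_{L²(Ω)} + ‖B(·,T)‖²_{L²(Ω)} + η²‖J(·,T)‖²_{L²(Ω)} ≤ ‖E(·,0)‖²_{L²(Ω)} + ‖B(·,0)‖²_{L²(Ω)} + η²‖J(·,0)‖²_{L²(Ω)} + (8π/η + η³M)∫₀ᵀ‖E(·,t)‖²_{L²(Ω)} dt + (4πη + 2ν_eη² + η)∫₀ᵀ‖J(·,t)‖²_{L²(Ω)} dt + 4πη∫₀ᵀ‖∂ₜP(·,t)‖²_{L²(Ω)} dt. -/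
open MeasureTheory
open scoped RealInnerProductSpace

noncomputable section

section EnergyDensity

/-- The time derivative of a jointly `C¹` field is jointly continuous. -/
theorem continuous_deriv_time {F : V3 → ℝ → V3}
    (hF : ContDiff ℝ 1 (fun p : V3 × ℝ => F p.1 p.2)) :
    Continuous (fun p : V3 × ℝ => deriv (F p.1) p.2) := by
  have h : (fun p : V3 × ℝ => deriv (F p.1) p.2)
      = fun p => fderiv ℝ (fun p : V3 × ℝ => F p.1 p.2) p (0, 1) := by
    funext p
    have h1 : HasFDerivAt (fun p : V3 × ℝ => F p.1 p.2)
        (fderiv ℝ (fun p : V3 × ℝ => F p.1 p.2) p) (p.1, p.2) :=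
      (hF.differentiable one_ne_zero p).hasFDerivAt
    exact (h1.comp_hasDerivAt p.2 ((hasDerivAt_const p.2 p.1).prodMk (hasDerivAt_id p.2))).deriv
  rw [h]
  exact (hF.continuous_fderiv one_ne_zero).clm_apply continuous_const

theorem ContDiff.time_section {F : V3 → ℝ → V3}
    (hF : ContDiff ℝ 1 (fun p : V3 × ℝ => F p.1 p.2)) (x : V3) : ContDiff ℝ 1 (F x) :=
  hF.comp (contDiff_const.prodMk contDiff_id)

theorem ContDiff.space_section {F : V3 → ℝ → V3}
    (hF : ContDiff ℝ 1 (fun p : V3 × ℝ => F p.1 p.2)) (t : ℝ) :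
    ContDiff ℝ 1 (fun x => F x t) :=
  hF.comp (contDiff_id.prodMk contDiff_const)

theorem hasDerivAt_norm_sq_time {F : V3 → ℝ → V3}
    (hF : ContDiff ℝ 1 (fun p : V3 × ℝ => F p.1 p.2)) (x : V3) (t : ℝ) :
    HasDerivAt (fun s => ‖F x s‖ ^ 2) (2 * ⟪F x t, deriv (F x) t⟫) t :=
  ((hF.time_section x).differentiable one_ne_zero t).hasDerivAt.norm_sq

end EnergyDensity

section LinearCombination

variable {α : Type*} [MeasurableSpace α] {μ : Measure α} {f g h : α → ℝ}

theorem MeasureTheory.Integrable.linear_combination_three (hf : Integrable f μ)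
    (hg : Integrable g μ) (hh : Integrable h μ) (a b d : ℝ) :
    Integrable (fun x => a * f x + b * g x + d * h x) μ :=
  ((hf.const_mul a).add (hg.const_mul b)).add (hh.const_mul d)

theorem integral_linear_combination_three (hf : Integrable f μ) (hg : Integrable g μ)
    (hh : Integrable h μ) (a b d : ℝ) :
    ∫ x, (a * f x + b * g x + d * h x) ∂μ
      = a * (∫ x, f x ∂μ) + b * (∫ x, g x ∂μ) + d * (∫ x, h x ∂μ) := by
  have hfg : Integrable (fun x => a * f x + b * g x) μ := (hf.const_mul a).add (hg.const_mul b)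
  rw [integral_add hfg (hh.const_mul d), integral_add (hf.const_mul a) (hg.const_mul b),
    integral_const_mul, integral_const_mul, integral_const_mul]

end LinearCombination

section BoundedDomain

variable {Ω : Set V3}

theorem Continuous.integrable_restrict_of_isBounded {φ : V3 → ℝ} (hφ : Continuous φ)
    (hΩb : Bornology.IsBounded Ω) : Integrable φ (volume.restrict Ω) :=
  (hφ.continuousOn.integrableOn_compact hΩb.isCompact_closure).mono_set subset_closure

theorem Continuous.integrable_prod_restrict_of_isBounded {φ : V3 × ℝ → ℝ} (hφ : Continuous φ)
    (hΩb : Bornology.IsBounded Ω) (T : ℝ) :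
    Integrable φ ((volume.restrict Ω).prod (volume.restrict (Set.Ioc 0 T))) := by
  rw [Measure.prod_restrict]
  exact (hφ.continuousOn.integrableOn_compact
    (hΩb.isCompact_closure.prod isCompact_Icc)).mono_set
    (Set.prod_mono subset_closure Set.Ioc_subset_Icc_self)

theorem Continuous.intervalIntegrable_setIntegral {φ : V3 × ℝ → ℝ} (hφ : Continuous φ)
    (hΩb : Bornology.IsBounded Ω) {T : ℝ} (hT : 0 ≤ T) :
    IntervalIntegrable (fun t => ∫ x in Ω, φ (x, t)) volume 0 T := by
  rw [intervalIntegrable_iff_integrableOn_Ioc_of_le hT]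
  exact (hφ.integrable_prod_restrict_of_isBounded hΩb T).integral_prod_right

/-- Integrating a time derivative over a bounded domain and a time interval. -/
theorem setIntegral_sub_eq_intervalIntegral_setIntegral {f : V3 → ℝ → ℝ} {φ : V3 × ℝ → ℝ}
    (hφ : Continuous φ) (hf : Continuous (fun p : V3 × ℝ => f p.1 p.2))
    (hderiv : ∀ x t, HasDerivAt (f x) (φ (x, t)) t)
    (hΩb : Bornology.IsBounded Ω) {T : ℝ} (hT : 0 ≤ T) :
    (∫ x in Ω, f x T) - ∫ x in Ω, f x 0 = ∫ t in (0 : ℝ)..T, ∫ x in Ω, φ (x, t) := by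
  have hsec : ∀ t, Continuous (fun x => f x t) := fun t => by fun_prop
  rw [← integral_sub ((hsec T).integrable_restrict_of_isBounded hΩb)
    ((hsec 0).integrable_restrict_of_isBounded hΩb), intervalIntegral.integral_of_le hT,
    ← integral_integral_swap (f := fun x t => φ (x, t)) (hφ.integrable_prod_restrict_of_isBounded hΩb T)]
  refine integral_congr_ae (.of_forall fun x => ?_)
  dsimp only
  rw [← intervalIntegral.integral_of_le hT, intervalIntegral.integral_eq_sub_of_hasDerivAt
    (fun t _ => hderiv x t)
    ((by fun_prop : Continuous fun t => φ (x, t)).intervalIntegrable 0 T)]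

end BoundedDomain

section Curl

theorem ContDiff.continuous_pd {g : V3 → ℝ} (hg : ContDiff ℝ 1 g) (i : Fin 3) :
    Continuous (pd i g) :=
  (hg.continuous_fderiv one_ne_zero).clm_apply continuous_const

theorem HasCompactSupport.pd {g : V3 → ℝ} (hg : HasCompactSupport g) (i : Fin 3) :
    HasCompactSupport (pd i g) :=
  (hg.fderiv (𝕜 := ℝ)).comp_left (g := fun L : V3 →L[ℝ] ℝ => L (EuclideanSpace.single i 1)) rfl

/-- Integration by parts for compactly supported `C¹` functions. -/
theorem integral_mul_pd_add_mul_pd {f g : V3 → ℝ} (hf : ContDiff ℝ 1 f) (hg : ContDiff ℝ 1 g)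
    (hfc : HasCompactSupport f) (hgc : HasCompactSupport g) (i : Fin 3) :
    Integrable (fun x => f x * pd i g x + g x * pd i f x) ∧
      ∫ x, (f x * pd i g x + g x * pd i f x) = 0 := by
  have h1 : Integrable (fun x => f x * pd i g x) :=
    (hf.continuous.mul (hg.continuous_pd i)).integrable_of_hasCompactSupport hfc.mul_right
  have h2 : Integrable (fun x => pd i f x * g x) :=
    ((hf.continuous_pd i).mul hg.continuous).integrable_of_hasCompactSupport hgc.mul_left
  have h3 : Integrable (fun x => f x * g x) :=
    (hf.continuous.mul hg.continuous).integrable_of_hasCompactSupport hfc.mul_right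
  have h := integral_mul_fderiv_eq_neg_fderiv_mul_of_integrable h2 h1 h3
    (fun x _ => hf.differentiable one_ne_zero x) (fun x _ => hg.differentiable one_ne_zero x)
  simp_rw [mul_comm (g _)]
  refine ⟨h1.add h2, ?_⟩
  rw [integral_add h1 h2]
  exact eq_neg_iff_add_eq_zero.mp h

/-- The curl is symmetric on compactly supported `C¹` fields. -/
theorem integral_inner_scurl_sub_inner_scurl {F G : V3 → V3} (hF : ContDiff ℝ 1 F)
    (hG : ContDiff ℝ 1 G) (hFc : HasCompactSupport F) (hGc : HasCompactSupport G) :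
    Integrable (fun x => ⟪F x, scurl G x⟫ - ⟪G x, scurl F x⟫) ∧
      ∫ x, (⟪F x, scurl G x⟫ - ⟪G x, scurl F x⟫) = 0 := by
  have hFi : ∀ i, ContDiff ℝ 1 (fun x => F x i) := contDiff_euclidean.mp hF
  have hGi : ∀ i, ContDiff ℝ 1 (fun x => G x i) := contDiff_euclidean.mp hG
  have hFci : ∀ i, HasCompactSupport (fun x => F x i) := fun i =>
    hFc.comp_left (g := fun v : V3 => v i) rfl
  have hGci : ∀ i, HasCompactSupport (fun x => G x i) := fun i =>
    hGc.comp_left (g := fun v : V3 => v i) rfl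
  have key := fun i j k => integral_mul_pd_add_mul_pd (hFi i) (hGi j) (hFci i) (hGci j) k
  have hexp : (fun x => ⟪F x, scurl G x⟫ - ⟪G x, scurl F x⟫) = fun x =>
      ((F x 0 * pd 1 (fun y => G y 2) x + G x 2 * pd 1 (fun y => F y 0) x)
        - (F x 0 * pd 2 (fun y => G y 1) x + G x 1 * pd 2 (fun y => F y 0) x)
        + (F x 1 * pd 2 (fun y => G y 0) x + G x 0 * pd 2 (fun y => F y 1) x)
        - (F x 1 * pd 0 (fun y => G y 2) x + G x 2 * pd 0 (fun y => F y 1) x)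
        + (F x 2 * pd 0 (fun y => G y 1) x + G x 1 * pd 0 (fun y => F y 2) x)
        - (F x 2 * pd 1 (fun y => G y 0) x + G x 0 * pd 1 (fun y => F y 2) x)) := by
    funext x
    simp [PiLp.inner_apply, Fin.sum_univ_three, scurl, vec3]
    ring
  rw [hexp]
  have hadd {f g : V3 → ℝ} (hf : Integrable f ∧ ∫ x, f x = 0)
      (hg : Integrable g ∧ ∫ x, g x = 0) :
      Integrable (fun x => f x + g x) ∧ ∫ x, (f x + g x) = 0 :=
    ⟨hf.1.add hg.1, by rw [integral_add hf.1 hg.1, hf.2, hg.2, add_zero]⟩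
  have hsub {f g : V3 → ℝ} (hf : Integrable f ∧ ∫ x, f x = 0)
      (hg : Integrable g ∧ ∫ x, g x = 0) :
      Integrable (fun x => f x - g x) ∧ ∫ x, (f x - g x) = 0 :=
    ⟨hf.1.sub hg.1, by rw [integral_sub hf.1 hg.1, hf.2, hg.2, sub_zero]⟩
  exact hsub (hadd (hsub (hadd (hsub (key 0 2 1) (key 0 1 2)) (key 1 0 2)) (key 1 2 0))
    (key 2 1 0)) (key 2 0 1)

theorem setIntegral_inner_scurl_sub_inner_scurl {Ω K L : Set V3} {F G : V3 → V3}
    (hF : ContDiff ℝ 1 F) (hG : ContDiff ℝ 1 G)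
    (hK : IsCompact K) (hKΩ : K ⊆ Ω) (hFK : Function.support F ⊆ K)
    (hL : IsCompact L) (hLΩ : L ⊆ Ω) (hGL : Function.support G ⊆ L) :
    Integrable (fun x => ⟪F x, scurl G x⟫ - ⟪G x, scurl F x⟫) ∧
      ∫ x in Ω, (⟪F x, scurl G x⟫ - ⟪G x, scurl F x⟫) = 0 := by
  have hFc : HasCompactSupport F := .of_support_subset_isCompact hK hFK
  have hGc : HasCompactSupport G := .of_support_subset_isCompact hL hGL
  have h := integral_inner_scurl_sub_inner_scurl hF hG hFc hGc
  refine ⟨h.1, ?_⟩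
  rw [setIntegral_eq_integral_of_forall_compl_eq_zero, h.2]
  intro x hx
  have hFx : F x = 0 := Function.notMem_support.mp fun hm => hx (hKΩ (hFK hm))
  have hGx : G x = 0 := Function.notMem_support.mp fun hm => hx (hLΩ (hGL hm))
  simp [hFx, hGx]

end Curl

section Young

theorem two_mul_inner_le_norm_sq_add_norm_sq (u v : V3) :
    2 * ⟪u, v⟫ ≤ ‖u‖ ^ 2 + ‖v‖ ^ 2 := by
  have h := norm_sub_sq_real u v
  linarith [sq_nonneg ‖u - v‖]

/-- The Young inequality with weight `η`. -/
theorem neg_two_mul_inner_le_div_add_mul {η : ℝ} (hη : 0 < η) (u v : V3) :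
    -(2 * ⟪u, v⟫) ≤ ‖u‖ ^ 2 / η + η * ‖v‖ ^ 2 := by
  have h := norm_add_sq_real u (η • v)
  rw [real_inner_smul_right, norm_smul, mul_pow, Real.norm_eq_abs, sq_abs] at h
  have h0 : 0 ≤ (‖u‖ ^ 2 + 2 * (η * ⟪u, v⟫) + η ^ 2 * ‖v‖ ^ 2) / η := by
    rw [← h]
    positivity
  have h1 : (‖u‖ ^ 2 + 2 * (η * ⟪u, v⟫) + η ^ 2 * ‖v‖ ^ 2) / η
      = ‖u‖ ^ 2 / η + 2 * ⟪u, v⟫ + η * ‖v‖ ^ 2 := by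
    field_simp
  linarith

/-- Pointwise bound on the rate of change of the energy density. -/
theorem energy_density_rate_le {c ν η M n : ℝ} (hν : 0 ≤ ν) (hη : 0 < η) (hn : n ^ 2 ≤ M)
    (e b j p ce cb : V3) :
    2 * ⟪e, c • cb - (4 * Real.pi) • p - (4 * Real.pi) • j⟫ + 2 * ⟪b, -(c • ce)⟫
        + η ^ 2 * (2 * ⟪j, -(ν • j) + n • e⟫)
      ≤ 2 * c * (⟪e, cb⟫ - ⟪b, ce⟫)
        + ((8 * Real.pi / η + η ^ 3 * M) * ‖e‖ ^ 2
          + (4 * Real.pi * η + 2 * ν * η ^ 2 + η) * ‖j‖ ^ 2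
          + 4 * Real.pi * η * ‖p‖ ^ 2) := by
  have hp := mul_le_mul_of_nonneg_left (neg_two_mul_inner_le_div_add_mul hη e p)
    (by positivity : 0 ≤ 4 * Real.pi)
  have hj := mul_le_mul_of_nonneg_left (neg_two_mul_inner_le_div_add_mul hη e j)
    (by positivity : 0 ≤ 4 * Real.pi)
  have hne := two_mul_inner_le_norm_sq_add_norm_sq j ((η * n) • e)
  rw [real_inner_smul_right, norm_smul, mul_pow, Real.norm_eq_abs, sq_abs] at hne
  have hne' := mul_le_mul_of_nonneg_left hne hη.le
  have hM : η ^ 3 * n ^ 2 * ‖e‖ ^ 2 ≤ η ^ 3 * M * ‖e‖ ^ 2 := by gcongr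
  have hνj : 0 ≤ ν * η ^ 2 * ‖j‖ ^ 2 := by positivity
  simp only [inner_sub_right, inner_add_right, inner_neg_right, real_inner_smul_right,
    real_inner_self_eq_norm_sq]
  have h8 : 8 * Real.pi / η * ‖e‖ ^ 2 = 2 * (4 * Real.pi * (‖e‖ ^ 2 / η)) := by ring
  linarith

end Young

theorem EBJ_energy_estimate (Ω : Set V3) (hΩo : IsOpen Ω) (hΩb : Bornology.IsBounded Ω)
    (T : ℝ) (hT : 0 < T)
    (c : ℝ) (hc : 0 < c) (νe : ℝ) (hνe : 0 ≤ νe)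
    (E B P J : V3 → ℝ → V3) (Ne : V3 → ℝ → ℝ)
    (hE : ContDiff ℝ 1 (fun p : V3 × ℝ => E p.1 p.2)) (hB : ContDiff ℝ 1 (fun p : V3 × ℝ => B p.1 p.2))
    (hP : ContDiff ℝ 1 (fun p : V3 × ℝ => P p.1 p.2)) (hJ : ContDiff ℝ 1 (fun p : V3 × ℝ => J p.1 p.2))
    (hNe : Continuous (fun p : V3 × ℝ => Ne p.1 p.2))
    (hAmp : ∀ x : V3, ∀ t ∈ Set.Icc (0:ℝ) T,
      deriv (E x) t = c • scurl (fun y => B y t) x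
        - (4*Real.pi) • deriv (P x) t - (4*Real.pi) • J x t)
    (hFar : ∀ x : V3, ∀ t ∈ Set.Icc (0:ℝ) T,
      deriv (B x) t = -(c • scurl (fun y => E y t) x))
    (hDrude : ∀ x : V3, ∀ t ∈ Set.Icc (0:ℝ) T,
      deriv (J x) t = -(νe • J x t) + Ne x t • E x t)
    (hEbc : DirichletBC Ω T E) (hBbc : DirichletBC Ω T B) (hJbc : DirichletBC Ω T J)
    (η : ℝ) (hη : 0 < η) (M : ℝ)
    (hM : IsLUB {r : ℝ | ∃ x ∈ Ω, ∃ t ∈ Set.Icc (0:ℝ) T, r = (Ne x t)^2} M) :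
    (∫ x in Ω, ‖E x T‖^2) + (∫ x in Ω, ‖B x T‖^2) + η^2 * (∫ x in Ω, ‖J x T‖^2)
      ≤ (∫ x in Ω, ‖E x 0‖^2) + (∫ x in Ω, ‖B x 0‖^2) + η^2 * (∫ x in Ω, ‖J x 0‖^2)
        + (8*Real.pi/η + η^3*M) * (∫ t in (0:ℝ)..T, ∫ x in Ω, ‖E x t‖^2)
        + (4*Real.pi*η + 2*νe*η^2 + η) * (∫ t in (0:ℝ)..T, ∫ x in Ω, ‖J x t‖^2)
        + 4*Real.pi*η * (∫ t in (0:ℝ)..T, ∫ x in Ω, ‖deriv (P x) t‖^2) := by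
  obtain ⟨KE, hKE, hKEΩ, hEK⟩ := hEbc
  obtain ⟨KB, hKB, hKBΩ, hBK⟩ := hBbc
  have hE' := continuous_deriv_time hE
  have hB' := continuous_deriv_time hB
  have hJ' := continuous_deriv_time hJ
  have hP' := continuous_deriv_time hP
  have hEc := hE.continuous
  have hBc := hB.continuous
  have hJc := hJ.continuous
  have hint {φ : V3 × ℝ → ℝ} (hφ : Continuous φ) (t : ℝ) :
      Integrable (fun x => φ (x, t)) (volume.restrict Ω) :=
    (by fun_prop : Continuous fun x => φ (x, t)).integrable_restrict_of_isBounded hΩb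
  have cE : Continuous fun p : V3 × ℝ => ‖E p.1 p.2‖ ^ 2 := by fun_prop
  have cB : Continuous fun p : V3 × ℝ => ‖B p.1 p.2‖ ^ 2 := by fun_prop
  have cJ : Continuous fun p : V3 × ℝ => ‖J p.1 p.2‖ ^ 2 := by fun_prop
  have cP : Continuous fun p : V3 × ℝ => ‖deriv (P p.1) p.2‖ ^ 2 := by fun_prop
  set a := 8 * Real.pi / η + η ^ 3 * M
  set b := 4 * Real.pi * η + 2 * νe * η ^ 2 + η
  set d := 4 * Real.pi * η
  let φ : V3 × ℝ → ℝ := fun p => 2 * ⟪E p.1 p.2, deriv (E p.1) p.2⟫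
    + 2 * ⟪B p.1 p.2, deriv (B p.1) p.2⟫ + η ^ 2 * (2 * ⟪J p.1 p.2, deriv (J p.1) p.2⟫)
  have hφ : Continuous φ := by
    have h1 := hEc.inner (𝕜 := ℝ) hE'
    have h2 := hBc.inner (𝕜 := ℝ) hB'
    have h3 := hJc.inner (𝕜 := ℝ) hJ'
    fun_prop
  have henergy (t : ℝ) :
      ∫ x in Ω, (‖E x t‖ ^ 2 + ‖B x t‖ ^ 2 + η ^ 2 * ‖J x t‖ ^ 2)
        = (∫ x in Ω, ‖E x t‖ ^ 2) + (∫ x in Ω, ‖B x t‖ ^ 2)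
          + η ^ 2 * (∫ x in Ω, ‖J x t‖ ^ 2) := by
    simpa using integral_linear_combination_three (hint cE t) (hint cB t) (hint cJ t) 1 1 (η ^ 2)
  have hbalance := setIntegral_sub_eq_intervalIntegral_setIntegral (Ω := Ω)
    (f := fun x t => ‖E x t‖ ^ 2 + ‖B x t‖ ^ 2 + η ^ 2 * ‖J x t‖ ^ 2) hφ (by fun_prop)
    (fun x t => ((hasDerivAt_norm_sq_time hE x t).add (hasDerivAt_norm_sq_time hB x t)).add
      ((hasDerivAt_norm_sq_time hJ x t).const_mul (η ^ 2))) hΩb hT.le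
  rw [henergy, henergy] at hbalance
  have hrate : ∀ t ∈ Set.Icc (0 : ℝ) T, ∫ x in Ω, φ (x, t)
      ≤ a * (∫ x in Ω, ‖E x t‖ ^ 2) + b * (∫ x in Ω, ‖J x t‖ ^ 2)
        + d * (∫ x in Ω, ‖deriv (P x) t‖ ^ 2) := by
    intro t ht
    obtain ⟨hcurl, hcurl0⟩ := setIntegral_inner_scurl_sub_inner_scurl
      (hE.space_section t) (hB.space_section t) hKE hKEΩ (hEK t ht) hKB hKBΩ (hBK t ht)
    have hEJP := (hint cE t).linear_combination_three (hint cJ t) (hint cP t) a b d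
    calc ∫ x in Ω, φ (x, t)
        ≤ ∫ x in Ω, (2 * c * (⟪E x t, scurl (fun y => B y t) x⟫
              - ⟪B x t, scurl (fun y => E y t) x⟫)
            + (a * ‖E x t‖ ^ 2 + b * ‖J x t‖ ^ 2 + d * ‖deriv (P x) t‖ ^ 2)) := by
          refine setIntegral_mono_on (hint hφ t)
            ((hcurl.integrableOn.const_mul _).add hEJP) hΩo.measurableSet fun x hx => ?_
          simp only [φ, hAmp x t ht, hFar x t ht, hDrude x t ht]
          exact energy_density_rate_le hνe hη (hM.1 ⟨x, hx, t, ht, rfl⟩) _ _ _ _ _ _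
      _ = _ := by
          rw [integral_add (hcurl.integrableOn.const_mul _) hEJP, integral_const_mul,
            hcurl0, mul_zero, zero_add,
            integral_linear_combination_three (hint cE t) (hint cJ t) (hint cP t)]
  have iE := (cE.intervalIntegrable_setIntegral hΩb hT.le).const_mul a
  have iJ := (cJ.intervalIntegrable_setIntegral hΩb hT.le).const_mul b
  have iP := (cP.intervalIntegrable_setIntegral hΩb hT.le).const_mul d
  have hmono := intervalIntegral.integral_mono_on hT.le
    (hφ.intervalIntegrable_setIntegral hΩb hT.le) ((iE.add iJ).add iP) hrate
  rw [intervalIntegral.integral_add (iE.add iJ) iP, intervalIntegral.integral_add iE iJ,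
    intervalIntegral.integral_const_mul, intervalIntegral.integral_const_mul,
    intervalIntegral.integral_const_mul, ← hbalance] at hmono
  linarith
end
end
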